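/- In the quantum torus realization of the mutated cluster, the iterated commutators of B_0 = U^{−1} with L = V^{−1} + (1 − U^2)V recover the dual Toda Hamiltonians: define operators on finitely supported functions f : ℤ → ℚ(s) (with q = s^2) by (U f)(n) = q^n f(n), (V f)(n) = f(n−1), B_0 = U^{−1}, L f(n) = f(n+1) + (1 − q^{2n}) f(n−1), and set B_{m+1} = (q − q^{−1})^{−1} (q^{1/2} B_m ∘ L − q^{−1/2} L ∘ B_m) with q^{1/2} = s. Then B_1 = q^{1/2} V^{−1} U^{−1}, i.e. (B_1 f)(n) = q^{1/2} q^{−(n+1)} f(n+1), and B_2 = q (V^{−2} U^{−1} − U), i.e. (B_2 f)(n) = q^{−n−1} f(n+2) − q^{n+1} f(n). -/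

import Mathlib

/-!
STATEMENT 18: In the quantum torus realization of the mutated cluster, the iterated
commutators of `B₀ = U⁻¹` with `L = V⁻¹ + (1 − U²)V` recover the dual Toda Hamiltonians:
with `(U f)(n) = q^n f(n)`, `(V f)(n) = f(n−1)`, `B₀ = U⁻¹`,
`(L f)(n) = f(n+1) + (1 − q^{2n}) f(n−1)`, and
`B_{m+1} = (q − q⁻¹)⁻¹ (q^{1/2} B_m ∘ L − q^{−1/2} L ∘ B_m)` (with `q^{1/2} = s`), one has
`B₁ = q^{1/2} V⁻¹ U⁻¹`, i.e. `(B₁ f)(n) = q^{1/2} q^{−(n+1)} f(n+1)`, and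
`B₂ = q (V⁻² U⁻¹ − U)`, i.e. `(B₂ f)(n) = q^{−n−1} f(n+2) − q^{n+1} f(n)`.

We realize `ℚ(s)` as `RatFunc ℚ` with `s = RatFunc.X` and `q = s²`; finitely supported
functions `f : ℤ → ℚ(s)` are those with finite support.
-/

noncomputable section

/-- The field `ℚ(s)`. -/
abbrev K : Type := RatFunc ℚ

/-- The element `s = q^{1/2}`. -/
def s : K := RatFunc.X

/-- The element `q = s²`. -/
def q : K := s ^ 2

/-- The trace-of-monodromy operator `L = V⁻¹ + (1 − U²)V` in the mutated cluster:
`(L f)(n) = f(n+1) + (1 − q^{2n}) f(n−1)`. -/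
def L (f : ℤ → K) : ℤ → K := fun n => f (n + 1) + (1 - q ^ (2 * n)) * f (n - 1)

/-- The operators `B_m`, defined by `B₀ = U⁻¹` and the Dehn-twist recursion
`B_{m+1} = (q − q⁻¹)⁻¹ (q^{1/2} B_m ∘ L − q^{−1/2} L ∘ B_m)`. -/
def B : ℕ → (ℤ → K) → (ℤ → K)
  | 0 => fun f n => q ^ (-n) * f n
  | m + 1 => fun f n => (q - q⁻¹)⁻¹ * (s * B m (L f) n - s⁻¹ * L (B m f) n)

theorem s_ne_zero : s ≠ 0 := RatFunc.X_ne_zero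

theorem q_ne_zero : q ≠ 0 := pow_ne_zero 2 s_ne_zero

theorem s_pow_four_ne_one : s ^ 4 - 1 ≠ 0 := by
  intro h
  have h1 : algebraMap (Polynomial ℚ) (RatFunc ℚ) (Polynomial.X ^ 4 - 1) = 0 := by
    simpa [s] using h
  have h2 : (Polynomial.X ^ 4 - 1 : Polynomial ℚ) = 0 :=
    (map_eq_zero_iff _ (RatFunc.algebraMap_injective ℚ)).1 h1
  have h3 := congrArg (Polynomial.eval 0) h2
  simp at h3

theorem q_sub_inv_ne_zero : q - q⁻¹ ≠ 0 := by
  intro h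
  apply s_pow_four_ne_one
  have h2 : q * (q - q⁻¹) = s ^ 4 - 1 := by
    rw [mul_sub, mul_inv_cancel₀ q_ne_zero, q]; ring
  rw [← h2, h, mul_zero]

theorem B_one (f : ℤ → K) (n : ℤ) : B 1 f n = s * q ^ (-(n + 1)) * f (n + 1) := by
  have hs := s_ne_zero
  have hq := q_ne_zero
  have hz : q ^ n ≠ 0 := zpow_ne_zero n hq
  simp only [B, L]
  rw [inv_mul_eq_iff_eq_mul₀ q_sub_inv_ne_zero]
  simp only [neg_add, neg_sub, sub_eq_add_neg, zpow_add₀ hq, zpow_neg, two_mul, zpow_one, neg_neg]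
  generalize q ^ n = z at *
  simp only [q] at *
  field_simp
  ring

theorem B_two (f : ℤ → K) (n : ℤ) :
    B 2 f n = q ^ (-n - 1) * f (n + 2) - q ^ (n + 1) * f n := by
  have hs := s_ne_zero
  have hq := q_ne_zero
  have hz : q ^ n ≠ 0 := zpow_ne_zero n hq
  have e : B 2 f n = (q - q⁻¹)⁻¹ * (s * B 1 (L f) n - s⁻¹ * L (B 1 f) n) := rfl
  rw [e, inv_mul_eq_iff_eq_mul₀ q_sub_inv_ne_zero, B_one]
  simp only [L, B_one]
  have e1 : n + 1 + 1 = n + 2 := by ring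
  have e2 : n + 1 - 1 = n := by ring
  have e3 : n - 1 + 1 = n := by ring
  rw [e1, e2, e3]
  have e4 : n + 2 = n + 1 + 1 := by ring
  have a1 : q ^ (-(n + 1)) = (q ^ n)⁻¹ * q⁻¹ := by
    rw [neg_add, zpow_add₀ hq, zpow_neg, zpow_neg, zpow_one]
  have a2 : q ^ (-(n + 2)) = (q ^ n)⁻¹ * q⁻¹ * q⁻¹ := by
    rw [zpow_neg, e4, zpow_add₀ hq, zpow_add₀ hq, zpow_one, mul_inv, mul_inv]
  have a3 : q ^ (-n - 1) = (q ^ n)⁻¹ * q⁻¹ := by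
    rw [← a1]; congr 1; ring
  have a4 : q ^ (2 * (n + 1)) = (q ^ n * q) * (q ^ n * q) := by
    rw [two_mul, zpow_add₀ hq, zpow_add₀ hq, zpow_one]
  have a5 : q ^ (2 * n) = q ^ n * q ^ n := by rw [two_mul, zpow_add₀ hq]
  have a6 : q ^ (n + 1) = q ^ n * q := by rw [zpow_add₀ hq, zpow_one]
  rw [a1, a2, a3, a4, a5, a6, zpow_neg]
  clear a1 a2 a3 a4 a5 a6
  generalize q ^ n = z at *
  simp only [q] at *
  field_simp
  ring

/-- The identities `B₁ = q^{1/2} V⁻¹U⁻¹` and `B₂ = q (V⁻²U⁻¹ − U)`. -/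
theorem dehn_twist_recovers_toda (f : ℤ → K) (hf : (Function.support f).Finite) (n : ℤ) :
    B 1 f n = s * q ^ (-(n + 1)) * f (n + 1) ∧
    B 2 f n = q ^ (-n - 1) * f (n + 2) - q ^ (n + 1) * f n := by
  exact ⟨B_one f n, B_two f n⟩

end
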